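/- Let G be a triangle-free finite simple graph on n ≥ 1 vertices and let λ > 0. For each vertex u set g_u = λ/(1+λ) if d_u = 0, and g_u = (λ/(1+λ))·W(d_u·log(1+λ))/(d_u·log(1+λ)) if d_u ≥ 1. Then (1/n)·Σ_{u∈V(G)} p_u/g_u ≥ 1. -/

import Mathlib

open scoped Classical

/-- The finset of independent sets of a finite simple graph (the empty set counts). -/
noncomputable def indepSets {V : Type*} [Fintype V] (G : SimpleGraph V) : Finset (Finset V) :=
  Finset.univ.filter fun I => ∀ u ∈ I, ∀ v ∈ I, ¬ G.Adj u v

/-- The hard-core partition function `Z_G(λ) = Σ_{I independent} λ^|I|`. -/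
noncomputable def hcZ {V : Type*} [Fintype V] (G : SimpleGraph V) (l : ℝ) : ℝ :=
  ∑ I ∈ indepSets G, l ^ I.card

/-- The probability that vertex `u` lies in a random independent set drawn from the
hard-core model on `G` at fugacity `λ`. -/
noncomputable def hcMarginal {V : Type*} [Fintype V] (G : SimpleGraph V) (l : ℝ) (u : V) : ℝ :=
  (∑ I ∈ (indepSets G).filter (fun I => u ∈ I), l ^ I.card) / hcZ G l

/-- The function `t ↦ ∫₀ᵗ s e⁻ˢ ds`. -/
noncomputable def incGamma (t : ℝ) : ℝ := 1 - (1 + t) * Real.exp (-t)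

/-- The function `x ↦ eˣ / (1 + x)`. -/
noncomputable def expRatio (x : ℝ) : ℝ := Real.exp x / (1 + x)

lemma hasDerivAt_incGamma (t : ℝ) : HasDerivAt incGamma (t * Real.exp (-t)) t := by
  have h1 : HasDerivAt (fun t : ℝ => Real.exp (-t)) (-Real.exp (-t)) t := by
    simpa using (hasDerivAt_neg t).exp
  have h2 := (((hasDerivAt_id t).const_add 1).mul h1).const_sub 1
  exact h2.congr_deriv (by simp; ring)

lemma hasDerivAt_expRatio {x : ℝ} (hx : 0 ≤ x) :
    HasDerivAt expRatio (x * Real.exp x / (1 + x) ^ 2) x := by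
  have h2 := (Real.hasDerivAt_exp x).div ((hasDerivAt_id x).const_add 1)
    (by positivity)
  exact h2.congr_deriv (by simp; ring)

lemma expRatio_pos {x : ℝ} (hx : 0 ≤ x) : 0 < expRatio x := by
  unfold expRatio; positivity

lemma one_le_expRatio {x : ℝ} (hx : 0 ≤ x) : 1 ≤ expRatio x := by
  rw [expRatio, le_div_iff₀ (by positivity)]
  linarith [Real.add_one_le_exp x]

lemma expRatio_mul_incGamma {x : ℝ} (hx : 0 ≤ x) : expRatio x * incGamma x = expRatio x - 1 := by
  have : 1 + x ≠ 0 := by positivity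
  rw [expRatio, incGamma, Real.exp_neg]
  field_simp

lemma expRatio_add {w D : ℝ} (hw : 0 ≤ w) (hD : 0 ≤ D) :
    expRatio (w + D) * ((1 + w + D) / (1 + w)) = expRatio w * Real.exp D := by
  rw [expRatio, expRatio, Real.exp_add]
  field_simp
  ring

lemma expRatio_mono {w x : ℝ} (hw : 0 ≤ w) (h : w ≤ x) : expRatio w ≤ expRatio x := by
  have hx := hw.trans h
  rw [expRatio, expRatio, div_le_div_iff₀ (by positivity) (by positivity)]
  have h1 := Real.add_one_le_exp (x - w)
  have h2 : Real.exp x = Real.exp w * Real.exp (x - w) := by rw [← Real.exp_add]; ring_nf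
  rw [h2, mul_assoc]
  gcongr
  nlinarith [mul_nonneg hw (sub_nonneg.2 h)]

/-- `e^y (1 - y / (1 + w))` is maximal at `y = w`. -/
lemma exp_mul_one_sub_le {w : ℝ} (hw : 0 ≤ w) (y : ℝ) :
    Real.exp y * (1 - y / (1 + w)) ≤ expRatio w := by
  have h1 := Real.add_one_le_exp (w - y)
  have h2 : Real.exp w = Real.exp y * Real.exp (w - y) := by rw [← Real.exp_add]; ring_nf
  have h3 : 1 - y / (1 + w) = (w - y + 1) / (1 + w) := by field_simp; ring
  rw [expRatio, h2, h3, mul_div_assoc]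
  gcongr

lemma incGamma_div_sq_antitone {t m : ℝ} (ht : 0 < t) (h : t ≤ m) :
    incGamma m * t ^ 2 ≤ incGamma t * m ^ 2 := by
  have key : AntitoneOn (fun s => incGamma s / s ^ 2) (Set.Ioi 0) := by
    have hd : ∀ s ∈ Set.Ioi (0 : ℝ), HasDerivAt (fun s => incGamma s / s ^ 2)
        ((s * Real.exp (-s) * s ^ 2 - incGamma s * (2 * s)) / (s ^ 2) ^ 2) s := by
      intro s hs
      have hs' : s ^ 2 ≠ 0 := pow_ne_zero _ (ne_of_gt hs)
      have := (hasDerivAt_incGamma s).div (hasDerivAt_pow 2 s) hs'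
      exact this.congr_deriv (by simp)
    refine antitoneOn_of_deriv_nonpos (convex_Ioi 0)
      (fun s hs => (hd s hs).continuousAt.continuousWithinAt) ?_ ?_
    · rw [interior_Ioi]
      exact fun s hs => (hd s hs).differentiableAt.differentiableWithinAt
    · rw [interior_Ioi]
      intro s hs
      have hs0 : 0 < s := hs
      rw [(hd s hs).deriv]
      apply div_nonpos_of_nonpos_of_nonneg _ (by positivity)
      have h1 := Real.quadratic_le_exp_of_nonneg hs0.le
      have h2 : Real.exp s * Real.exp (-s) = 1 := by rw [← Real.exp_add]; simp
      have h3 := Real.exp_pos (-s)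
      have h4 : (1 + s + s ^ 2 / 2) * Real.exp (-s) ≤ 1 := by
        calc _ ≤ Real.exp s * Real.exp (-s) := by gcongr
          _ = 1 := h2
      rw [incGamma]
      nlinarith
  have := key (Set.mem_Ioi.2 ht) (Set.mem_Ioi.2 (ht.trans_le h)) h
  have hm := ht.trans_le h
  simp only at this
  rwa [div_le_div_iff₀ (by positivity) (by positivity)] at this

lemma expRatio_sub_one_div_sq_antitone {w x : ℝ} (hw : 0 ≤ w) (h : w ≤ x) (hx : x ≤ 1) :
    (expRatio x - 1) * w ^ 2 ≤ (expRatio w - 1) * x ^ 2 := by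
  rcases hw.eq_or_lt with rfl | hw
  · simp [expRatio]
  have key : AntitoneOn (fun s => (expRatio s - 1) / s ^ 2) (Set.Ioc 0 1) := by
    have hd : ∀ s ∈ Set.Ioc (0 : ℝ) 1, HasDerivAt (fun s => (expRatio s - 1) / s ^ 2)
        ((s * Real.exp s / (1 + s) ^ 2 * s ^ 2 - (expRatio s - 1) * (2 * s)) / (s ^ 2) ^ 2) s := by
      intro s hs
      have hs' : s ^ 2 ≠ 0 := pow_ne_zero _ (ne_of_gt hs.1)
      have := ((hasDerivAt_expRatio hs.1.le).sub_const 1).div (hasDerivAt_pow 2 s) hs'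
      exact this.congr_deriv (by simp)
    refine antitoneOn_of_deriv_nonpos (convex_Ioc 0 1)
      (fun s hs => (hd s hs).continuousAt.continuousWithinAt) ?_ ?_
    · exact fun s hs => (hd s (interior_subset hs)).differentiableAt.differentiableWithinAt
    · intro s hs
      have hs := interior_subset hs
      have hs0 : 0 < s := hs.1
      have hs1 : s ≤ 1 := hs.2
      rw [(hd s hs).deriv]
      apply div_nonpos_of_nonpos_of_nonneg _ (by positivity)
      have h1 : 1 + s + s ^ 2 / 2 + s ^ 3 / 6 ≤ Real.exp s := by
        have := Real.sum_le_exp_of_nonneg hs0.le 4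
        simpa [Finset.sum_range_succ, Nat.factorial] using this
      have h2 : 2 * (1 + s) ^ 2 ≤ Real.exp s * (2 + 2 * s - s ^ 2) := by
        have h3 : 0 ≤ 2 + 2 * s - s ^ 2 := by nlinarith
        refine le_trans ?_ (mul_le_mul_of_nonneg_right h1 h3)
        have h4 : 0 ≤ s ^ 3 := by positivity
        nlinarith [mul_nonneg h4 (sub_nonneg.2 hs1),
          mul_nonneg (mul_nonneg h4 hs0.le) (sub_nonneg.2 hs1)]
      have h5 : s * Real.exp s / (1 + s) ^ 2 * s ^ 2 - (expRatio s - 1) * (2 * s)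
          = s / (1 + s) ^ 2 * (2 * (1 + s) ^ 2 - Real.exp s * (2 + 2 * s - s ^ 2)) := by
        rw [expRatio]; field_simp; ring
      rw [h5]
      exact mul_nonpos_of_nonneg_of_nonpos (by positivity) (by linarith)
  have := key ⟨hw, h.trans hx⟩ ⟨hw.trans_le h, hx⟩ h
  have hm := hw.trans_le h
  simp only at this
  rwa [div_le_div_iff₀ (by positivity) (by positivity)] at this

lemma concaveOn_incGamma : ConcaveOn ℝ (Set.Ici 1) incGamma := by
  have hd : deriv incGamma = fun t => t * Real.exp (-t) :=
    funext fun t => (hasDerivAt_incGamma t).deriv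
  have hd2 : ∀ t, HasDerivAt (fun t => t * Real.exp (-t)) ((1 - t) * Real.exp (-t)) t := by
    intro t
    have h1 : HasDerivAt (fun t : ℝ => Real.exp (-t)) (-Real.exp (-t)) t := by
      simpa using (hasDerivAt_neg t).exp
    exact ((hasDerivAt_id t).mul h1).congr_deriv (by simp; ring)
  apply concaveOn_of_deriv2_nonpos (convex_Ici 1)
  · exact fun t _ => (hasDerivAt_incGamma t).continuousAt.continuousWithinAt
  · exact fun t _ => (hasDerivAt_incGamma t).differentiableAt.differentiableWithinAt
  · rw [hd]; exact fun t _ => (hd2 t).differentiableAt.differentiableWithinAt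
  · intro t ht
    rw [interior_Ici] at ht
    simp only [Function.iterate_succ, Function.iterate_zero, Function.comp, id, hd, (hd2 t).deriv]
    exact mul_nonpos_of_nonpos_of_nonneg (by linarith [Set.mem_Ioi.1 ht]) (Real.exp_pos _).le

lemma line_le_incGamma {a b x t : ℝ} (h1 : a * (1 - b) ≤ incGamma 1)
    (hx : a * (x - b) ≤ incGamma x) (ht : t ∈ Set.Icc 1 x) : a * (t - b) ≤ incGamma t := by
  have hc : ConcaveOn ℝ (Set.Ici 1) (fun t => incGamma t - a * (t - b)) := by
    apply concaveOn_incGamma.sub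
    refine ⟨convex_Ici 1, fun p _ q _ s r _ _ hsr => le_of_eq ?_⟩
    linear_combination a * b * hsr
  have := hc.min_le_of_mem_Icc (Set.mem_Ici.2 le_rfl)
    (Set.mem_Ici.2 (ht.1.trans ht.2)) ht
  have h2 : 0 ≤ min (incGamma 1 - a * (1 - b)) (incGamma x - a * (x - b)) :=
    le_min (by linarith) (by linarith)
  linarith

lemma one_sub_mul_exp_le {r : ℝ} (hr : 0 ≤ r) : (1 - r) * Real.exp r ≤ 1 - r ^ 2 / 2 := by
  have key : AntitoneOn (fun s : ℝ => (1 - s) * Real.exp s + s ^ 2 / 2) (Set.Ici 0) := by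
    have hd : ∀ s : ℝ, HasDerivAt (fun s : ℝ => (1 - s) * Real.exp s + s ^ 2 / 2)
        (s * (1 - Real.exp s)) s := by
      intro s
      exact ((((hasDerivAt_id s).const_sub 1).mul (Real.hasDerivAt_exp s)).add
        ((hasDerivAt_pow 2 s).div_const 2)).congr_deriv (by simp; ring)
    refine antitoneOn_of_deriv_nonpos (convex_Ici 0)
      (fun s _ => (hd s).continuousAt.continuousWithinAt)
      (fun s _ => (hd s).differentiableAt.differentiableWithinAt) fun s hs => ?_
    have hs := Set.mem_Ici.1 (interior_subset hs)
    rw [(hd s).deriv]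
    exact mul_nonpos_of_nonneg_of_nonpos hs (by linarith [Real.one_le_exp hs])
  have := key (Set.mem_Ici.2 le_rfl) (Set.mem_Ici.2 hr) hr
  simp at this
  linarith

/-- Chord bound for `expRatio` relative to `s ↦ s²`, for right end point at most `1`. -/
lemma expRatio_sub_le_of_le_one {w x : ℝ} (hw : 0 ≤ w) (h : w ≤ x) (hx : x ≤ 1) :
    (expRatio x - expRatio w) * x ^ 2 ≤ (x ^ 2 - w ^ 2) * (expRatio x * incGamma x) := by
  rw [expRatio_mul_incGamma (hw.trans h)]
  linarith [expRatio_sub_one_div_sq_antitone hw h hx]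

lemma quarter_le_incGamma_one : 1 / 4 ≤ incGamma 1 := by
  have h := Real.exp_one_gt_d9
  have h2 : Real.exp 1 * Real.exp (-1) = 1 := by rw [← Real.exp_add]; simp
  have h3 := Real.exp_pos (-1)
  rw [incGamma]
  nlinarith

lemma expRatio_sub_eq {w D : ℝ} (hw : 0 ≤ w) (hD : 0 ≤ D) :
    expRatio (w + D) - expRatio w
      = expRatio (w + D) * (1 - Real.exp (-D) * (1 + D / (1 + w))) := by
  have h := expRatio_add hw hD
  have h2 : Real.exp D * Real.exp (-D) = 1 := by rw [← Real.exp_add]; simp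
  have h3 : (1 + w + D) / (1 + w) = 1 + D / (1 + w) := by field_simp
  rw [h3] at h
  linear_combination Real.exp (-D) * h + expRatio w * h2

/-- Chord bound for `expRatio` relative to `s ↦ s²`, for right end point at least `1`. -/
lemma expRatio_sub_le_of_one_le {w D : ℝ} (hw : 0 ≤ w) (hD : 0 < D) (hx : 1 ≤ w + D) :
    expRatio (w + D) - expRatio w
      ≤ ((w + D) ^ 2 - w ^ 2) * (expRatio (w + D) * incGamma 1) := by
  rw [expRatio_sub_eq hw hD.le]
  suffices h : 1 - Real.exp (-D) * (1 + D / (1 + w)) ≤ D * (2 * w + D) * incGamma 1 by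
    nlinarith [mul_le_mul_of_nonneg_left h (expRatio_pos (by linarith : 0 ≤ w + D)).le]
  have h4 := quarter_le_incGamma_one
  obtain ⟨v, hv, hvw, hv2, hbase⟩ : ∃ v, 0 ≤ v ∧ v ≤ w ∧ 2 ≤ (1 + D) * (1 + v) ^ 2 ∧
      1 - Real.exp (-D) * (1 + D / (1 + v)) ≤ D * (2 * v + D) * incGamma 1 := by
    rcases le_total D 1 with hD1 | hD1
    · refine ⟨1 - D, by linarith, by linarith, ?_, ?_⟩
      · nlinarith [mul_nonneg hD.le (sub_nonneg.2 hD1)]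
      · have h := expRatio_sub_le_of_le_one (by linarith : 0 ≤ 1 - D)
          (by linarith : 1 - D ≤ 1) le_rfl
        have h' := expRatio_sub_eq (by linarith : 0 ≤ 1 - D) hD.le
        rw [sub_add_cancel] at h'
        rw [h'] at h
        have hp := expRatio_pos zero_le_one
        refine le_of_mul_le_mul_left ?_ hp
        linarith
    · refine ⟨0, le_rfl, hw, by linarith, ?_⟩
      have := incGamma_div_sq_antitone one_pos hD1
      have h2 : 1 - Real.exp (-D) * (1 + D / (1 + 0)) = incGamma D := by
        rw [incGamma]; simp; ring
      rw [h2]; linarith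
  have h5 : D / (1 + v) - D / (1 + w) = D * (w - v) * (1 / ((1 + v) * (1 + w))) := by
    field_simp; ring
  have h6 : Real.exp (-D) * (1 / ((1 + v) * (1 + w))) ≤ 1 / 2 := by
    have h7 : 1 + D ≤ Real.exp D := by linarith [Real.add_one_le_exp D]
    rw [Real.exp_neg, ← one_div, one_div_mul_one_div]
    apply one_div_le_one_div_of_le (by norm_num)
    calc 2 ≤ (1 + D) * (1 + v) ^ 2 := hv2
      _ = (1 + D) * ((1 + v) * (1 + v)) := by ring
      _ ≤ _ := by gcongr
  have h8 : 0 ≤ D * (w - v) := mul_nonneg hD.le (by linarith)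
  have h9 : Real.exp (-D) * (D / (1 + v) - D / (1 + w)) ≤ 2 * (D * (w - v)) * incGamma 1 := by
    rw [h5]
    nlinarith [mul_le_mul_of_nonneg_left h6 h8, mul_le_mul_of_nonneg_left h4 h8]
  linarith

/-- Reduction of the pair of exponential inequalities to one-sided estimates on each side of the
point `w + r₀ = x - t₀` where the line `expRatio x - K y` takes the value `expRatio w`. -/
lemma line_separates {w x t₀ K : ℝ} (hw : 0 ≤ w) (hwx : w ≤ x) (hK : 0 ≤ K)
    (hKη : K * (x - t₀) = expRatio x - expRatio w)
    (hP : ∀ r, x - t₀ - w ≤ r → K * (r - (x - t₀ - w)) ≤ expRatio w * (1 - (1 - r) * Real.exp r))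
    (hQ : ∀ t, t₀ ≤ t → t ≤ x → K * (t - t₀) ≤ expRatio x * incGamma t) {y : ℝ} (hy : 0 ≤ y) :
    Real.exp y * (1 - y / (1 + w)) ≤ expRatio x - K * y ∧
      Real.exp y * (1 - y / (1 + x)) ≤ expRatio w + K * y := by
  have hx := hw.trans hwx
  rcases le_total y (x - t₀) with h | h
  · have hKy := mul_le_mul_of_nonneg_left h hK
    refine ⟨(exp_mul_one_sub_le hw y).trans (by linarith), ?_⟩
    have h1 := hQ (x - y) (by linarith) (by linarith)
    have h2 : Real.exp y * (1 - y / (1 + x)) = expRatio x * (1 - incGamma (x - y)) := by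
      have : Real.exp y = Real.exp x * Real.exp (-(x - y)) := by rw [← Real.exp_add]; ring_nf
      rw [this, expRatio, incGamma]
      field_simp
      ring
    rw [h2]
    linarith
  · have hKy := mul_le_mul_of_nonneg_left h hK
    refine ⟨?_, (exp_mul_one_sub_le hx y).trans (by linarith)⟩
    have h1 := hP (y - w) (by linarith)
    have h2 : Real.exp y * (1 - y / (1 + w))
        = expRatio w * ((1 - (y - w)) * Real.exp (y - w)) := by
      have : Real.exp y = Real.exp w * Real.exp (y - w) := by rw [← Real.exp_add]; ring_nf
      rw [this, expRatio]
      field_simp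
      ring
    rw [h2]
    linarith

lemma exp_le_of_le_two {D : ℝ} (hD : 0 ≤ D) (hD2 : D ≤ 2) :
    Real.exp D ≤ (1 + D) * (1 + D ^ 2 / 2) := by
  obtain ⟨s, rfl⟩ : ∃ s, D = s + s := ⟨D / 2, by ring⟩
  have hs : 0 ≤ s := by linarith
  have hs1 : s ≤ 1 := by linarith
  have h := Real.exp_bound' hs hs1 (n := 3) (by norm_num)
  simp only [Finset.sum_range_succ, Finset.sum_range_zero, Nat.factorial] at h
  norm_num at h
  have h2 : Real.exp s ≤ 1 + s + s ^ 2 / 2 + s ^ 3 / 4 := by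
    have : 0 ≤ s ^ 3 := by positivity
    linarith
  rw [Real.exp_add]
  refine (mul_self_le_mul_self (Real.exp_pos s).le h2).trans ?_
  have h3 : 0 ≤ s ^ 3 := by positivity
  have h4 : s ^ 4 ≤ s ^ 3 := pow_le_pow_of_le_one hs hs1 (by norm_num)
  have h5 : s ^ 5 ≤ s ^ 3 := pow_le_pow_of_le_one hs hs1 (by norm_num)
  have h6 : s ^ 6 ≤ s ^ 3 := pow_le_pow_of_le_one hs hs1 (by norm_num)
  nlinarith

lemma exists_line_of_le_two {w D : ℝ} (hw : 0 ≤ w) (hD : 0 < D) (hD2 : D ≤ 2) :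
    ∃ K : ℝ, ∀ y, 0 ≤ y →
      Real.exp y * (1 - y / (1 + w)) ≤ expRatio (w + D) - K * y ∧
      Real.exp y * (1 - y / (1 + (w + D))) ≤ expRatio w + K * y := by
  have hx : 0 < w + D := by linarith
  have hη : 0 < w + D / 2 := by linarith
  have hCx := expRatio_pos hx.le
  have hCw := expRatio_pos hw
  have hmono := expRatio_mono hw (by linarith : w ≤ w + D)
  have hR : 0 ≤ (expRatio (w + D) - expRatio w) / (w + D / 2) :=
    div_nonneg (by linarith) hη.le
  have hKη : (expRatio (w + D) - expRatio w) / (w + D / 2) * (w + D / 2)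
      = expRatio (w + D) - expRatio w := by field_simp
  set K := (expRatio (w + D) - expRatio w) / (w + D / 2) with hKdef
  refine ⟨K, fun y hy => line_separates (t₀ := D / 2) hw (by linarith) hR ?_ ?_ ?_ hy⟩
  · rw [← hKη]; ring
  · intro r hr
    have hr' : D / 2 ≤ r := by linarith
    have hr0 : 0 ≤ r := by linarith
    have hKle : K ≤ D * expRatio w := by
      rw [hKdef, div_le_iff₀ hη]
      have h1 := expRatio_add hw hD.le
      have hq : 0 < (1 + w + D) / (1 + w) := by positivity
      have h2 : Real.exp D ≤ (1 + D * (w + D / 2)) * ((1 + w + D) / (1 + w)) := by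
        refine (exp_le_of_le_two hD.le hD2).trans ?_
        rw [mul_div_assoc', le_div_iff₀ (by positivity)]
        nlinarith [mul_nonneg hD.le (sq_nonneg w),
          mul_nonneg (mul_nonneg (sq_nonneg D) hw) (sub_nonneg.2 hD2)]
      have h3 := mul_le_mul_of_nonneg_left h2 hCw.le
      rw [← h1, ← mul_assoc] at h3
      linarith [le_of_mul_le_mul_right h3 hq]
    have h1 := one_sub_mul_exp_le hr0
    have h2 : D * (r - D / 2) ≤ r ^ 2 / 2 := by nlinarith [sq_nonneg (r - D)]
    calc K * (r - (w + D - D / 2 - w)) = K * (r - D / 2) := by ring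
      _ ≤ D * expRatio w * (r - D / 2) := by gcongr
      _ = expRatio w * (D * (r - D / 2)) := by ring
      _ ≤ _ := by gcongr; linarith
  · have hend : K * (w + D - D / 2) ≤ expRatio (w + D) * incGamma (w + D) := by
      rw [expRatio_mul_incGamma hx.le]
      have := one_le_expRatio hw
      linarith
    have hlow : ∀ m, 0 < m → (expRatio (w + D) - expRatio w) * m ^ 2
        ≤ ((w + D) ^ 2 - w ^ 2) * (expRatio (w + D) * incGamma m) →
        ∀ t, D / 2 ≤ t → t ≤ m → K * (t - D / 2) ≤ expRatio (w + D) * incGamma t := by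
      intro m hm h t ht htm
      have ht0 : 0 < t := by linarith
      have h1 := incGamma_div_sq_antitone ht0 htm
      have h2 : K * m ^ 2 ≤ 2 * D * (expRatio (w + D) * incGamma m) := by
        refine le_of_mul_le_mul_right ?_ hη
        rw [← hKη] at h
        linarith
      have h3 : 2 * D * (t - D / 2) ≤ t ^ 2 := by nlinarith [sq_nonneg (t - D)]
      have hKm : 0 ≤ expRatio (w + D) * incGamma m := by
        have : 0 ≤ K * m ^ 2 := by positivity
        by_contra hneg
        nlinarith
      refine le_of_mul_le_mul_right ?_ (pow_pos hm 2)
      calc K * (t - D / 2) * m ^ 2 = K * m ^ 2 * (t - D / 2) := by ring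
        _ ≤ 2 * D * (expRatio (w + D) * incGamma m) * (t - D / 2) := by gcongr
        _ = (expRatio (w + D) * incGamma m) * (2 * D * (t - D / 2)) := by ring
        _ ≤ (expRatio (w + D) * incGamma m) * t ^ 2 := by gcongr
        _ = expRatio (w + D) * (incGamma m * t ^ 2) := by ring
        _ ≤ expRatio (w + D) * (incGamma t * m ^ 2) := by gcongr
        _ = _ := by ring
    intro t ht htx
    rcases le_total (w + D) 1 with h1 | h1
    · exact hlow _ hx (expRatio_sub_le_of_le_one hw (by linarith) h1) t ht htx
    · have hlow1 := hlow 1 one_pos (by simpa using expRatio_sub_le_of_one_le hw hD h1)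
      rcases le_total t 1 with ht1 | ht1
      · exact hlow1 t ht ht1
      · have e : ∀ s, K / expRatio (w + D) * (s - D / 2) = K * (s - D / 2) / expRatio (w + D) :=
          fun s => by ring
        have := line_le_incGamma (a := K / expRatio (w + D)) (b := D / 2) (x := w + D) (t := t)
          (by rw [e, div_le_iff₀' hCx]; exact hlow1 1 (by linarith) le_rfl)
          (by rw [e, div_le_iff₀' hCx]; exact hend) ⟨ht1, htx⟩
        rwa [e, div_le_iff₀' hCx] at this

lemma exists_line_of_two_le {w D : ℝ} (hw : 0 ≤ w) (hD : 2 ≤ D) :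
    ∃ K : ℝ, ∀ y, 0 ≤ y →
      Real.exp y * (1 - y / (1 + w)) ≤ expRatio (w + D) - K * y ∧
      Real.exp y * (1 - y / (1 + (w + D))) ≤ expRatio w + K * y := by
  have hx : 0 < w + D := by linarith
  have hη : 0 < w + D - 1 := by linarith
  have hCx := expRatio_pos hx.le
  have hCw := expRatio_pos hw
  have hmono := expRatio_mono hw (by linarith : w ≤ w + D)
  have hR : 0 ≤ (expRatio (w + D) - expRatio w) / (w + D - 1) :=
    div_nonneg (by linarith) hη.le
  have hKη : (expRatio (w + D) - expRatio w) / (w + D - 1) * (w + D - 1)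
      = expRatio (w + D) - expRatio w := by field_simp
  set K := (expRatio (w + D) - expRatio w) / (w + D - 1) with hKdef
  refine ⟨K, fun y hy => line_separates (t₀ := 1) hw (by linarith) hR hKη ?_ ?_ hy⟩
  · intro r hr
    have hr' : 0 ≤ r - (D - 1) := by linarith
    have hKle : K ≤ expRatio w * ((D - 1) * Real.exp (D - 1)) := by
      rw [hKdef, div_le_iff₀ hη]
      have h1 := expRatio_add hw (by linarith : 0 ≤ D)
      have he : Real.exp D = Real.exp 1 * Real.exp (D - 1) := by rw [← Real.exp_add]; ring_nf
      have h3 : Real.exp 1 < 3 := by linarith [Real.exp_one_lt_d9]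
      have h4 : 3 ≤ (D - 1) * (w + D - 1) * ((1 + w + D) / (1 + w)) := by
        rw [mul_div_assoc', le_div_iff₀ (by positivity)]
        nlinarith [mul_nonneg hw hw, mul_nonneg hw (sub_nonneg.2 hD),
          mul_nonneg (sub_nonneg.2 hD) (sub_nonneg.2 hD),
          mul_nonneg (mul_nonneg hw (sub_nonneg.2 hD)) (sub_nonneg.2 hD),
          mul_nonneg (mul_nonneg hw hw) (sub_nonneg.2 hD),
          mul_nonneg (mul_nonneg (sub_nonneg.2 hD) (sub_nonneg.2 hD)) (sub_nonneg.2 hD)]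
      have hq : 0 < (1 + w + D) / (1 + w) := by positivity
      suffices h : expRatio (w + D) ≤ expRatio w * ((D - 1) * Real.exp (D - 1)) * (w + D - 1) by
        linarith
      refine le_of_mul_le_mul_right ?_ hq
      rw [h1, he]
      calc expRatio w * (Real.exp 1 * Real.exp (D - 1))
          ≤ expRatio w * (((D - 1) * (w + D - 1) * ((1 + w + D) / (1 + w))) * Real.exp (D - 1)) := by
            gcongr; linarith
        _ = _ := by ring
    have h1 : (D - 1) * Real.exp (D - 1) * (r - (D - 1)) ≤ 1 - (1 - r) * Real.exp r := by
      have hr2 : Real.exp r = Real.exp (D - 1) * Real.exp (r - (D - 1)) := by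
        rw [← Real.exp_add]; ring_nf
      have h2 : (r - 1) * (r - (D - 1) + 1) ≤ (r - 1) * Real.exp (r - (D - 1)) := by
        gcongr
        · linarith
        · exact Real.add_one_le_exp _
      have h3 : (D - 1) * (r - (D - 1)) ≤ (r - 1) * (r - (D - 1) + 1) := by nlinarith
      have h4 := mul_le_mul_of_nonneg_left (h3.trans h2) (Real.exp_pos (D - 1)).le
      rw [hr2]
      linarith
    calc K * (r - (w + D - 1 - w)) = K * (r - (D - 1)) := by ring
      _ ≤ expRatio w * ((D - 1) * Real.exp (D - 1)) * (r - (D - 1)) := by gcongr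
      _ = expRatio w * ((D - 1) * Real.exp (D - 1) * (r - (D - 1))) := by ring
      _ ≤ _ := by gcongr
  · intro t ht htx
    have e : ∀ s, K / expRatio (w + D) * (s - 1) = K * (s - 1) / expRatio (w + D) :=
      fun s => by ring
    have := line_le_incGamma (a := K / expRatio (w + D)) (b := 1) (x := w + D) (t := t)
      (by simpa using (by linarith [quarter_le_incGamma_one] : 0 ≤ incGamma 1))
      (by
        rw [e, div_le_iff₀' hCx, expRatio_mul_incGamma hx.le]
        have := one_le_expRatio hw
        linarith) ⟨ht, htx⟩
    rwa [e, div_le_iff₀' hCx] at this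

/-- There is an antisymmetric kernel making the local occupancy inequality hold pairwise. -/
lemma exists_antisymm_kernel : ∃ k : ℝ → ℝ → ℝ, (∀ x w, k x w = -k w x) ∧
    ∀ x w y, 0 ≤ x → 0 ≤ w → 0 ≤ y →
      1 ≤ Real.exp (-y) * (expRatio x - y * k x w) + y / (1 + w) := by
  have hex : ∀ w x : ℝ, ∃ K : ℝ, 0 ≤ w → w < x → ∀ y, 0 ≤ y →
      Real.exp y * (1 - y / (1 + w)) ≤ expRatio x - K * y ∧
      Real.exp y * (1 - y / (1 + x)) ≤ expRatio w + K * y := by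
    intro w x
    by_cases h : 0 ≤ w ∧ w < x
    · rcases le_total (x - w) 2 with h2 | h2
      · obtain ⟨K, hK⟩ := exists_line_of_le_two h.1 (sub_pos.2 h.2) h2
        exact ⟨K, fun _ _ => by simpa using hK⟩
      · obtain ⟨K, hK⟩ := exists_line_of_two_le h.1 h2
        exact ⟨K, fun _ _ => by simpa using hK⟩
    · exact ⟨0, fun h1 h2 => absurd ⟨h1, h2⟩ h⟩
  choose K hK using hex
  refine ⟨fun x w => if w < x then K w x else if x < w then -K x w else 0, ?_, ?_⟩
  · intro x w
    rcases lt_trichotomy x w with h | rfl | h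
    · simp [h, h.not_gt]
    · simp
    · simp [h, h.not_gt]
  · intro x w y hx hw hy
    have hred : ∀ c, Real.exp y * (1 - y / (1 + w)) ≤ expRatio x - y * c →
        1 ≤ Real.exp (-y) * (expRatio x - y * c) + y / (1 + w) := by
      intro c h
      have h1 : Real.exp (-y) * (Real.exp y * (1 - y / (1 + w))) = 1 - y / (1 + w) := by
        rw [← mul_assoc, ← Real.exp_add]; simp
      have := mul_le_mul_of_nonneg_left h (Real.exp_pos (-y)).le
      linarith
    apply hred
    rcases lt_trichotomy x w with h | rfl | h
    · simp only [h, h.not_gt, if_true, if_false]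
      linarith [(hK x w hx h y hy).2]
    · simpa using exp_mul_one_sub_le hx y
    · simp only [h, if_true]
      linarith [(hK w x hw h y hy).1]

lemma not_adj_of_common_nbr {V : Type*} {G : SimpleGraph V} (hG : G.CliqueFree 3) {u v w : V}
    (hv : G.Adj u v) (hw : G.Adj u w) :
    ¬ G.Adj v w := fun h =>
  hG {u, v, w} (SimpleGraph.is3Clique_triple_iff.2 ⟨hv, hw, h⟩)

lemma sum_powerset_pow_card {V : Type*} (l : ℝ) (F : Finset V) :
    ∑ T ∈ F.powerset, l ^ T.card = (1 + l) ^ F.card := by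
  have := Finset.sum_pow_mul_eq_add_pow l 1 F
  simpa [add_comm] using this

section HardCore

variable {V : Type*} [Fintype V] (G : SimpleGraph V)

/-- The neighbours of `u` that have no neighbour in `I`. -/
noncomputable def freeNbrs (u : V) (I : Finset V) : Finset V :=
  (G.neighborFinset u).filter fun v => ∀ w ∈ I, ¬ G.Adj v w

/-- The independent sets that contain no neighbour of `u`. -/
noncomputable def uncovering (u : V) : Finset (Finset V) :=
  (indepSets G).filter fun I => ∀ w ∈ I, ¬ G.Adj u w

variable {G}

lemma mem_indepSets {I : Finset V} :
    I ∈ indepSets G ↔ ∀ u ∈ I, ∀ v ∈ I, ¬ G.Adj u v := by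
  simp [indepSets]

lemma mem_freeNbrs {u v : V} {I : Finset V} :
    v ∈ freeNbrs G u I ↔ G.Adj u v ∧ ∀ w ∈ I, ¬ G.Adj v w := by
  simp [freeNbrs]

lemma mem_uncovering {u : V} {I : Finset V} :
    I ∈ uncovering G u ↔ I ∈ indepSets G ∧ ∀ w ∈ I, ¬ G.Adj u w := by
  simp [uncovering]

lemma freeNbrs_sdiff (hG : G.CliqueFree 3) (u : V) (I : Finset V) :
    freeNbrs G u (I \ G.neighborFinset u) = freeNbrs G u I := by
  ext v
  simp only [mem_freeNbrs, Finset.mem_sdiff, SimpleGraph.mem_neighborFinset]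
  refine and_congr_right fun hv => ⟨fun h w hw hvw => ?_, fun h w hw => h w hw.1⟩
  exact h w ⟨hw, fun huw => not_adj_of_common_nbr hG hv huw hvw⟩ hvw

/-- The independent sets that agree with `J` off the neighbourhood of `u` are obtained from `J` by
adding an arbitrary set of free neighbours of `u`. -/
lemma sum_fiber_eq (hG : G.CliqueFree 3) (l : ℝ) {u : V} {J : Finset V}
    (hJ : J ∈ uncovering G u) :
    ∑ I ∈ (indepSets G).filter (fun I => I \ G.neighborFinset u = J), l ^ I.card
      = l ^ J.card * (1 + l) ^ (freeNbrs G u J).card := by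
  rw [← sum_powerset_pow_card, Finset.mul_sum]
  obtain ⟨hJi, hJu⟩ := mem_uncovering.1 hJ
  rw [mem_indepSets] at hJi
  have hTN : ∀ T ∈ (freeNbrs G u J).powerset, T ⊆ G.neighborFinset u := fun T hT v hv => by
    simpa using (mem_freeNbrs.1 (Finset.mem_powerset.1 hT hv)).1
  have hJN : Disjoint J (G.neighborFinset u) :=
    Finset.disjoint_left.2 fun w hw hw2 => hJu w hw (by simpa using hw2)
  refine Finset.sum_bij' (fun I _ => I ∩ G.neighborFinset u) (fun T _ => J ∪ T) ?_ ?_ ?_ ?_ ?_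
  · intro I hI
    obtain ⟨hIi, hIJ⟩ := Finset.mem_filter.1 hI
    rw [mem_indepSets] at hIi
    refine Finset.mem_powerset.2 fun v hv => ?_
    obtain ⟨hv1, hv2⟩ := Finset.mem_inter.1 hv
    rw [← hIJ, freeNbrs_sdiff hG]
    exact mem_freeNbrs.2 ⟨by simpa using hv2, hIi v hv1⟩
  · intro T hT
    have hTf : ∀ v ∈ T, G.Adj u v ∧ ∀ w ∈ J, ¬ G.Adj v w := fun v hv =>
      mem_freeNbrs.1 (Finset.mem_powerset.1 hT hv)
    refine Finset.mem_filter.2 ⟨mem_indepSets.2 fun a ha b hb => ?_, ?_⟩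
    · rcases Finset.mem_union.1 ha with ha | ha <;> rcases Finset.mem_union.1 hb with hb | hb
      · exact hJi a ha b hb
      · exact fun h => (hTf b hb).2 a ha h.symm
      · exact (hTf a ha).2 b hb
      · exact not_adj_of_common_nbr hG (hTf a ha).1 (hTf b hb).1
    · rw [Finset.union_sdiff_distrib, Finset.sdiff_eq_empty_iff_subset.2 (hTN T hT),
        Finset.union_empty, Finset.sdiff_eq_self_of_disjoint hJN]
  · intro I hI
    rw [← (Finset.mem_filter.1 hI).2, Finset.sdiff_union_inter]
  · intro T hT
    rw [Finset.union_inter_distrib_right, Finset.disjoint_iff_inter_eq_empty.1 hJN,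
      Finset.empty_union, Finset.inter_eq_left.2 (hTN T hT)]
  · intro I hI
    rw [← pow_add, ← (Finset.mem_filter.1 hI).2, Finset.card_sdiff_add_card_inter]

/-- Resampling the neighbourhood of `u`: given the rest of the independent set, `u` is uncovered
with probability `(1 + l)⁻¹` to the number of its free neighbours. -/
lemma sum_resample (hG : G.CliqueFree 3) {l : ℝ} (hl : 0 < l) (u : V) (φ : Finset V → ℝ) :
    ∑ I ∈ indepSets G, l ^ I.card * (((1 + l) ^ (freeNbrs G u I).card)⁻¹ * φ (freeNbrs G u I))
      = ∑ I ∈ uncovering G u, l ^ I.card * φ (freeNbrs G u I) := by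
  have hmaps : ∀ I ∈ indepSets G, I \ G.neighborFinset u ∈ uncovering G u := by
    intro I hI
    rw [mem_indepSets] at hI
    refine mem_uncovering.2 ⟨mem_indepSets.2 fun a ha b hb => ?_, fun w hw => ?_⟩
    · exact hI a (Finset.mem_sdiff.1 ha).1 b (Finset.mem_sdiff.1 hb).1
    · simpa using (Finset.mem_sdiff.1 hw).2
  rw [← Finset.sum_fiberwise_of_maps_to hmaps]
  refine Finset.sum_congr rfl fun J hJ => ?_
  have h1 : ∀ I ∈ (indepSets G).filter (fun I => I \ G.neighborFinset u = J),
      l ^ I.card * (((1 + l) ^ (freeNbrs G u I).card)⁻¹ * φ (freeNbrs G u I))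
        = l ^ I.card * (((1 + l) ^ (freeNbrs G u J).card)⁻¹ * φ (freeNbrs G u J)) := by
    intro I hI
    rw [← (Finset.mem_filter.1 hI).2, freeNbrs_sdiff hG]
  rw [Finset.sum_congr rfl h1, ← Finset.sum_mul, sum_fiber_eq hG l hJ]
  field_simp

lemma sum_uncovering_eq {l : ℝ} (hl : 0 < l) (u : V) :
    ∑ I ∈ uncovering G u, l ^ I.card
      = (1 + l) / l * ∑ I ∈ (indepSets G).filter (fun I => u ∈ I), l ^ I.card := by
  have h1 : (uncovering G u).filter (fun I => u ∈ I) = (indepSets G).filter (fun I => u ∈ I) := by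
    ext I
    simp only [Finset.mem_filter, mem_uncovering]
    exact ⟨fun h => ⟨h.1.1, h.2⟩, fun h => ⟨⟨h.1, mem_indepSets.1 h.1 u h.2⟩, h.2⟩⟩
  have h2 : ∑ I ∈ (indepSets G).filter (fun I => u ∈ I), l ^ I.card
      = l * ∑ I ∈ (uncovering G u).filter (fun I => u ∉ I), l ^ I.card := by
    rw [Finset.mul_sum]
    refine Finset.sum_bij' (fun I _ => I.erase u) (fun I _ => insert u I) ?_ ?_ ?_ ?_ ?_
    · intro I hI
      obtain ⟨hI, hu⟩ := Finset.mem_filter.1 hI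
      rw [mem_indepSets] at hI
      refine Finset.mem_filter.2 ⟨mem_uncovering.2 ⟨mem_indepSets.2 fun a ha b hb => ?_,
        fun w hw => ?_⟩, Finset.notMem_erase u I⟩
      · exact hI a (Finset.mem_of_mem_erase ha) b (Finset.mem_of_mem_erase hb)
      · exact hI u hu w (Finset.mem_of_mem_erase hw)
    · intro I hI
      obtain ⟨hI, hu⟩ := Finset.mem_filter.1 hI
      obtain ⟨hI, hunc⟩ := mem_uncovering.1 hI
      rw [mem_indepSets] at hI
      refine Finset.mem_filter.2 ⟨mem_indepSets.2 fun a ha b hb => ?_, Finset.mem_insert_self u I⟩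
      rcases Finset.mem_insert.1 ha with ha | ha <;> rcases Finset.mem_insert.1 hb with hb | hb
      · rw [ha, hb]; exact G.irrefl
      · rw [ha]; exact hunc b hb
      · rw [hb]; exact fun h => hunc a ha h.symm
      · exact hI a ha b hb
    · intro I hI
      exact Finset.insert_erase (Finset.mem_filter.1 hI).2
    · intro I hI
      exact Finset.erase_insert (Finset.mem_filter.1 hI).2
    · intro I hI
      have hu := (Finset.mem_filter.1 hI).2
      rw [← pow_succ', Finset.card_erase_add_one hu]
  rw [← Finset.sum_filter_add_sum_filter_not _ (fun I => u ∈ I), h1, h2]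
  field_simp
  ring

lemma sum_freeNbrs_eq (l : ℝ) (u : V) (m : V → ℝ) :
    ∑ I ∈ indepSets G, l ^ I.card * ∑ v ∈ freeNbrs G u I, m v
      = ∑ v ∈ G.neighborFinset u, m v * ∑ I ∈ uncovering G v, l ^ I.card := by
  simp only [freeNbrs, uncovering, Finset.sum_filter, Finset.mul_sum]
  rw [Finset.sum_comm]
  refine Finset.sum_congr rfl fun v _ => Finset.sum_congr rfl fun I _ => ?_
  split_ifs <;> ring

lemma sum_antisymm_eq_zero (l : ℝ) {κ : V → V → ℝ} (hκ : ∀ u v, κ u v = -κ v u) :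
    ∑ u, ∑ I ∈ uncovering G u, l ^ I.card * ∑ v ∈ freeNbrs G u I, κ u v = 0 := by
  have h1 : ∀ u, ∑ I ∈ uncovering G u, l ^ I.card * ∑ v ∈ freeNbrs G u I, κ u v
      = ∑ v, ∑ I ∈ indepSets G, if G.Adj u v ∧ (∀ w ∈ I, ¬ G.Adj u w) ∧ ∀ w ∈ I, ¬ G.Adj v w
        then l ^ I.card * κ u v else 0 := by
    intro u
    rw [Finset.sum_comm, uncovering, Finset.sum_filter]
    refine Finset.sum_congr rfl fun I _ => ?_
    have h2 : freeNbrs G u I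
        = Finset.univ.filter fun v => G.Adj u v ∧ ∀ w ∈ I, ¬ G.Adj v w := by
      ext v; simp [mem_freeNbrs]
    rw [h2, Finset.sum_filter, Finset.mul_sum]
    split_ifs with h
    · refine Finset.sum_congr rfl fun v _ => ?_
      have h3 : (G.Adj u v ∧ (∀ w ∈ I, ¬ G.Adj u w) ∧ ∀ w ∈ I, ¬ G.Adj v w) ↔
          (G.Adj u v ∧ ∀ w ∈ I, ¬ G.Adj v w) :=
        ⟨fun a => ⟨a.1, a.2.2⟩, fun a => ⟨a.1, h, a.2⟩⟩
      simp only [h3, mul_ite, mul_zero]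
    · exact (Finset.sum_eq_zero fun v _ => if_neg fun a => h a.2.1).symm
  simp only [h1]
  set S := ∑ u, ∑ v, ∑ I ∈ indepSets G, (if G.Adj u v ∧ (∀ w ∈ I, ¬ G.Adj u w) ∧
    ∀ w ∈ I, ¬ G.Adj v w then l ^ I.card * κ u v else 0) with hS
  have h3 : S = -S := by
    conv_lhs => rw [hS, Finset.sum_comm]
    rw [hS]
    simp only [← Finset.sum_neg_distrib]
    refine Finset.sum_congr rfl fun u _ => Finset.sum_congr rfl fun v _ =>
      Finset.sum_congr rfl fun I _ => ?_
    have h4 : (G.Adj v u ∧ (∀ w ∈ I, ¬ G.Adj v w) ∧ ∀ w ∈ I, ¬ G.Adj u w) ↔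
        (G.Adj u v ∧ (∀ w ∈ I, ¬ G.Adj u w) ∧ ∀ w ∈ I, ¬ G.Adj v w) := by
      rw [G.adj_comm]; tauto
    simp only [h4]
    split_ifs
    · rw [hκ v u]; ring
    · simp
  linarith

/-- Averaging the pairwise inequality over the set of free neighbours. -/
lemma one_le_local {ι : Type*} {l : ℝ} (hl : 0 < l) {k : ℝ → ℝ → ℝ}
    (hk : ∀ x w y, 0 ≤ x → 0 ≤ w → 0 ≤ y →
      1 ≤ Real.exp (-y) * (expRatio x - y * k x w) + y / (1 + w))
    {x : ℝ} (hx : 0 ≤ x) {X : ι → ℝ} (hX : ∀ v, 0 ≤ X v) (F : Finset ι) :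
    1 ≤ ((1 + l) ^ F.card)⁻¹ * (expRatio x - Real.log (1 + l) * ∑ v ∈ F, k x (X v))
      + Real.log (1 + l) * ∑ v ∈ F, 1 / (1 + X v) := by
  rcases F.eq_empty_or_nonempty with rfl | hF
  · simpa using one_le_expRatio hx
  have hc : (0 : ℝ) < F.card := by exact_mod_cast hF.card_pos
  have hL : 0 ≤ Real.log (1 + l) := Real.log_nonneg (by linarith)
  have hexp : Real.exp (-(F.card * Real.log (1 + l))) = ((1 + l) ^ F.card)⁻¹ := by
    rw [Real.exp_neg, Real.exp_nat_mul, Real.exp_log (by linarith)]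
  have h := Finset.sum_le_sum fun v (_ : v ∈ F) =>
    hk x (X v) (F.card * Real.log (1 + l)) hx (hX v) (mul_nonneg hc.le hL)
  rw [hexp] at h
  refine le_of_mul_le_mul_left ?_ hc
  simp only [Finset.sum_add_distrib, ← Finset.mul_sum, Finset.sum_sub_distrib, Finset.sum_const,
    nsmul_eq_mul, div_eq_mul_one_div (_ * Real.log (1 + l))] at h
  linarith

lemma card_mul_hcZ_le (hG : G.CliqueFree 3) {l : ℝ} (hl : 0 < l) {X : V → ℝ} (hX : ∀ u, 0 ≤ X u)
    (hd : ∀ u, X u * Real.exp (X u) = G.degree u * Real.log (1 + l)) :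
    Fintype.card V * hcZ G l ≤ ∑ u, Real.exp (X u) * ∑ I ∈ uncovering G u, l ^ I.card := by
  obtain ⟨k, hk, hk1⟩ := exists_antisymm_kernel
  have hlocal : ∀ u, hcZ G l ≤ expRatio (X u) * ∑ I ∈ uncovering G u, l ^ I.card
      - Real.log (1 + l) * (∑ I ∈ uncovering G u, l ^ I.card *
          ∑ v ∈ freeNbrs G u I, k (X u) (X v))
      + Real.log (1 + l) * ∑ v ∈ G.neighborFinset u,
          1 / (1 + X v) * ∑ I ∈ uncovering G v, l ^ I.card := by
    intro u
    have h1 := Finset.sum_le_sum fun I (_ : I ∈ indepSets G) =>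
      mul_le_mul_of_nonneg_left (one_le_local hl hk1 (hX u) hX (freeNbrs G u I))
        (pow_nonneg hl.le I.card)
    simp only [mul_one, mul_add, Finset.sum_add_distrib] at h1
    rw [sum_resample hG hl u (fun F => expRatio (X u) -
      Real.log (1 + l) * ∑ v ∈ F, k (X u) (X v))] at h1
    rw [← sum_freeNbrs_eq, hcZ]
    refine h1.trans (le_of_eq ?_)
    rw [Finset.mul_sum, Finset.mul_sum, Finset.mul_sum, ← Finset.sum_sub_distrib]
    congr 1 <;> exact Finset.sum_congr rfl fun I _ => by ring
  have hsum := Finset.sum_le_sum fun u (_ : u ∈ Finset.univ) => hlocal u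
  rw [Finset.sum_const, Finset.card_univ, nsmul_eq_mul, Finset.sum_add_distrib,
    Finset.sum_sub_distrib, ← Finset.mul_sum, ← Finset.mul_sum,
    sum_antisymm_eq_zero l (κ := fun u v => k (X u) (X v)) fun u v => hk _ _] at hsum
  have hswap : ∑ u, ∑ v ∈ G.neighborFinset u,
      1 / (1 + X v) * ∑ I ∈ uncovering G v, l ^ I.card
      = ∑ v, G.degree v * (1 / (1 + X v) * ∑ I ∈ uncovering G v, l ^ I.card) := by
    rw [Finset.sum_comm' (t' := Finset.univ) (s' := fun v => G.neighborFinset v)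
      (by simp [G.adj_comm])]
    simp
  rw [hswap, Finset.mul_sum, mul_zero, sub_zero, ← Finset.sum_add_distrib] at hsum
  refine hsum.trans (le_of_eq (Finset.sum_congr rfl fun u _ => ?_))
  have h1 : 1 + X u ≠ 0 := by linarith [hX u]
  have h2 : expRatio (X u) + G.degree u * Real.log (1 + l) * (1 / (1 + X u))
      = Real.exp (X u) := by
    rw [← hd, expRatio]; field_simp
  rw [← h2]; ring

lemma hcZ_pos {l : ℝ} (hl : 0 < l) : 0 < hcZ G l :=
  Finset.sum_pos (fun _ _ => pow_pos hl _) ⟨∅, by simp [mem_indepSets]⟩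

end HardCore

/-- In triangle-free graphs, the vertex-averaged local-occupancy inequality holds with
`g` defined via the positive real branch `W` of the Lambert W-function. -/
theorem stmt13 {V : Type*} [Fintype V] (G : SimpleGraph V) (hG : G.CliqueFree 3)
    (hn : 1 ≤ Fintype.card V) (l : ℝ) (hl : 0 < l)
    (W : ℝ → ℝ) (hW : ∀ x : ℝ, 0 < x → 0 ≤ W x ∧ W x * Real.exp (W x) = x) :
    1 ≤ (1 / (Fintype.card V : ℝ)) *
        ∑ u : V, hcMarginal G l u /
          (if G.degree u = 0 then l / (1 + l)
           else (l / (1 + l)) * W ((G.degree u : ℝ) * Real.log (1 + l)) /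
              ((G.degree u : ℝ) * Real.log (1 + l))) := by
  have hL : 0 < Real.log (1 + l) := Real.log_pos (by linarith)
  have hpos : ∀ u, G.degree u ≠ 0 → 0 < (G.degree u : ℝ) * Real.log (1 + l) := fun u h =>
    mul_pos (by exact_mod_cast Nat.pos_of_ne_zero h) hL
  set X : V → ℝ := fun u =>
    if G.degree u = 0 then 0 else W ((G.degree u : ℝ) * Real.log (1 + l)) with hXdef
  have hX : ∀ u, 0 ≤ X u := by
    intro u
    simp only [hXdef]
    split_ifs with h
    · exact le_rfl
    · exact (hW _ (hpos u h)).1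
  have hd : ∀ u, X u * Real.exp (X u) = G.degree u * Real.log (1 + l) := by
    intro u
    simp only [hXdef]
    split_ifs with h
    · simp [h]
    · exact (hW _ (hpos u h)).2
  have hg : ∀ u, (if G.degree u = 0 then l / (1 + l)
      else (l / (1 + l)) * W ((G.degree u : ℝ) * Real.log (1 + l)) /
        ((G.degree u : ℝ) * Real.log (1 + l))) = l / (1 + l) / Real.exp (X u) := by
    intro u
    split_ifs with h
    · simp [hXdef, h]
    · have hXu : X u = W ((G.degree u : ℝ) * Real.log (1 + l)) := by simp [hXdef, h]
      have hne : X u ≠ 0 := by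
        intro h0
        have := hd u
        rw [h0, zero_mul] at this
        exact (hpos u h).ne this
      rw [← hXu, ← hd u]
      field_simp
  have hterm : ∀ u, hcMarginal G l u / (l / (1 + l) / Real.exp (X u))
      = Real.exp (X u) * (∑ I ∈ uncovering G u, l ^ I.card) / hcZ G l := by
    intro u
    rw [hcMarginal, sum_uncovering_eq hl]
    field_simp
  have hn0 : (0 : ℝ) < Fintype.card V := by exact_mod_cast hn
  have hZ := hcZ_pos (G := G) hl
  simp only [hg, hterm]
  rw [← Finset.sum_div, one_div, ← div_eq_inv_mul, div_div, le_div_iff₀ (by positivity), one_mul,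
    mul_comm]
  exact card_mul_hcZ_le hG hl hX hd
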